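/- arXiv:2302.00931 — 2 statements merged into one kernel-verified Lean document; each statement's English description precedes it below -/
import Mathlib

section
/- Let A and B be commutative algebras over ℂ and let T : A → B be a ℂ-linear map such that T(e) is an idempotent of B whenever e is an idempotent of A. Then T is multiplicative on idempotents: for any idempotents e, f ∈ A, one has T(e·f) = T(e)·T(f). -/
/-- A ℂ-linear map preserving idempotents sends orthogonal idempotents to
orthogonal elements. -/
theorem map_mul_map_eq_zero_of_preserves_idempotents
    {A B : Type*} [CommRing A] [Algebra ℂ A] [CommRing B] [Algebra ℂ B]
    (T : A →ₗ[ℂ] B)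
    (hT : ∀ e : A, IsIdempotentElem e → IsIdempotentElem (T e))
    {e f : A} (he : IsIdempotentElem e) (hf : IsIdempotentElem f) (hef : e * f = 0) :
    T e * T f = 0 := by
  have hsum : IsIdempotentElem (e + f) := by
    unfold IsIdempotentElem at *
    linear_combination he + hf + 2 * hef
  have hTe := hT e he
  have hTf := hT f hf
  have hTsum := hT _ hsum
  unfold IsIdempotentElem at hTe hTf hTsum
  rw [map_add] at hTsum
  have htwo : (2 : ℂ) • (T e * T f) = 0 := by
    rw [two_smul]
    linear_combination hTsum - hTe - hTf
  exact (smul_eq_zero.mp htwo).resolve_left two_ne_zero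

/-- A ℂ-linear map between commutative ℂ-algebras sending idempotents
to idempotents is multiplicative on idempotents. -/
theorem idempotent_preserver_multiplicative_on_idempotents
    {A B : Type*} [CommRing A] [Algebra ℂ A] [CommRing B] [Algebra ℂ B]
    (T : A →ₗ[ℂ] B)
    (hT : ∀ e : A, IsIdempotentElem e → IsIdempotentElem (T e)) :
    ∀ e f : A, IsIdempotentElem e → IsIdempotentElem f →
      T (e * f) = T e * T f := by
  intro e f he hf
  have hp : IsIdempotentElem (e * f) := he.mul hf
  have hq : IsIdempotentElem (e * (1 - f)) := he.mul hf.one_sub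
  have hr : IsIdempotentElem (f * (1 - e)) := hf.mul he.one_sub
  have hpq : (e * f) * (e * (1 - f)) = 0 := by
    linear_combination -(e * e) * hf.eq
  have hpr : (e * f) * (f * (1 - e)) = 0 := by
    linear_combination -(f * f) * he.eq
  have hqr : (e * (1 - f)) * (f * (1 - e)) = 0 := by
    linear_combination -(e * (1 - e)) * hf.eq
  have hTpq := map_mul_map_eq_zero_of_preserves_idempotents T hT hp hq hpq
  have hTpr := map_mul_map_eq_zero_of_preserves_idempotents T hT hp hr hpr
  have hTqr := map_mul_map_eq_zero_of_preserves_idempotents T hT hq hr hqr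
  have hTe : T e = T (e * f) + T (e * (1 - f)) := by
    rw [← map_add]
    congr 1
    ring
  have hTf : T f = T (e * f) + T (f * (1 - e)) := by
    rw [← map_add]
    congr 1
    ring
  rw [hTe, hTf]
  linear_combination -(hT _ hp).eq - hTpq - hTpr - hTqr
end

section
/- Let A and B be commutative algebras over ℂ and let T : A → B be a ℂ-linear map such that T(e) is an idempotent of B whenever e is an idempotent of A. Then the restriction of T to the ℂ-linear span of the idempotents of A is multiplicative: for any x, y in the ℂ-linear span of the set of idempotents of A, T(x·y) = T(x)·T(y). -/
/-- An additive map preserving idempotents preserves orthogonality of idempotents. -/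
theorem map_mul_map_eq_zero_of_isIdempotentElem {A B : Type*} [CommRing A] [CommRing B]
    (h2 : IsUnit (2 : B)) (T : A →+ B)
    (hT : ∀ e : A, IsIdempotentElem e → IsIdempotentElem (T e))
    {p q : A} (hp : IsIdempotentElem p) (hq : IsIdempotentElem q) (hpq : p * q = 0) :
    T p * T q = 0 := by
  have hadd : IsIdempotentElem (p + q) := by
    unfold IsIdempotentElem at *
    linear_combination hp + hq + 2 * hpq
  have hTp := hT p hp
  have hTq := hT q hq
  have hTadd := hT _ hadd
  rw [map_add] at hTadd
  unfold IsIdempotentElem at hTp hTq hTadd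
  refine h2.mul_right_eq_zero.mp ?_
  linear_combination hTadd - hTp - hTq

/-- An additive map preserving idempotents is multiplicative on idempotents. -/
theorem map_mul_of_isIdempotentElem {A B : Type*} [CommRing A] [CommRing B]
    (h2 : IsUnit (2 : B)) (T : A →+ B)
    (hT : ∀ e : A, IsIdempotentElem e → IsIdempotentElem (T e))
    {e f : A} (he : IsIdempotentElem e) (hf : IsIdempotentElem f) :
    T (e * f) = T e * T f := by
  have hg := he.mul hf
  have ha := he.mul hf.one_sub
  have hb := hf.mul he.one_sub
  have hga := map_mul_map_eq_zero_of_isIdempotentElem h2 T hT hg ha <| by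
    linear_combination (-(e * e)) * hf.eq
  have hgb := map_mul_map_eq_zero_of_isIdempotentElem h2 T hT hg hb <| by
    linear_combination (-(f * f)) * he.eq
  have hab := map_mul_map_eq_zero_of_isIdempotentElem h2 T hT ha hb <| by
    linear_combination (-(f * (1 - f))) * he.eq
  have hTe : T e = T (e * f) + T (e * (1 - f)) := by
    rw [← map_add]
    congr 1
    ring
  have hTf : T f = T (e * f) + T (f * (1 - e)) := by
    rw [← map_add]
    congr 1
    ring
  rw [hTe, hTf]
  linear_combination -(hT _ hg).eq - hga - hgb - hab

/-- A ℂ-linear map between commutative ℂ-algebras sending idempotents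
to idempotents is multiplicative on the ℂ-linear span of the idempotents. -/
theorem idempotent_preserver_multiplicative_on_span
    {A B : Type*} [CommRing A] [Algebra ℂ A] [CommRing B] [Algebra ℂ B]
    (T : A →ₗ[ℂ] B)
    (hT : ∀ e : A, IsIdempotentElem e → IsIdempotentElem (T e)) :
    ∀ x y : A, x ∈ Submodule.span ℂ {e : A | IsIdempotentElem e} →
      y ∈ Submodule.span ℂ {e : A | IsIdempotentElem e} →
      T (x * y) = T x * T y := by
  intro x y hx hy
  have h2 : IsUnit (2 : B) := by
    simpa only [map_ofNat] using (IsUnit.mk0 (2 : ℂ) two_ne_zero).map (algebraMap ℂ B)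
  induction hx, hy using Submodule.span_induction₂ with
  | mem_mem e f he hf => exact map_mul_of_isIdempotentElem h2 T.toAddMonoidHom hT he hf
  | zero_left => simp
  | zero_right => simp
  | add_left x y z _ _ _ hx hy => simp [add_mul, hx, hy]
  | add_right x y z _ _ _ hx hy => simp [mul_add, hx, hy]
  | smul_left r x y _ _ h => simp [h]
  | smul_right r x y _ _ h => simp [h]
end
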